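/- Let n, d, k be positive integers with 1 ≤ k ≤ n. Let S_k denote the (k+1)×(k+1) symmetric tridiagonal matrix with zero diagonal and off-diagonal entries a_i = √((i+1)(n−i)) for i = 0,…,k−1, and let λmax denote the largest eigenvalue. If λmax(S_{k−1}) ≥ n − 2d and λmax(S_k) < n, then every code C ⊆ {0,1}^n with minimum Hamming distance at least d satisfies |C| ≤ 4(n−k)·C(n,k) / (n − λmax(S_k)). -/

import Mathlib

/-- Symmetric tridiagonal (k+1)×(k+1) matrix with diagonal `d 0, …, d k` and
off-diagonal `o 0, …, o (k-1)`. -/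
noncomputable def Tridiag (k : ℕ) (d o : ℕ → ℝ) : Matrix (Fin (k + 1)) (Fin (k + 1)) ℝ :=
  Matrix.of fun i j =>
    if (i : ℕ) = (j : ℕ) then d i
    else if (i : ℕ) + 1 = (j : ℕ) then o i
    else if (j : ℕ) + 1 = (i : ℕ) then o j
    else 0

/-- The largest eigenvalue of a real square matrix. -/
noncomputable def maxEig {m : ℕ} (M : Matrix (Fin m) (Fin m) ℝ) : ℝ :=
  sSup {μ : ℝ | Module.End.HasEigenvalue (Matrix.toLin' M) μ}

lemma sum_mul_sum_prod_eq {ι : Type*} [Fintype ι] [DecidableEq ι] (z : ι → ℝ)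
    (hz : ∀ i, z i * z i = 1) (g : ℕ → ℝ) :
    (∑ i, z i) * ∑ S : Finset ι, g S.card * ∏ i ∈ S, z i =
      ∑ S : Finset ι, (S.card * g (S.card - 1) +
        ((Fintype.card ι : ℝ) - S.card) * g (S.card + 1)) * ∏ i ∈ S, z i := by
  have key : ∀ i, z i * ∑ S : Finset ι, g S.card * ∏ j ∈ S, z j =
      ∑ S : Finset ι, (if i ∈ S then g (S.card - 1) else g (S.card + 1)) * ∏ j ∈ S, z j := by
    intro i
    let e : Finset ι ≃ Finset ι :=
      Function.Involutive.toPerm (fun S => if i ∈ S then S.erase i else insert i S) (by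
        intro S
        by_cases h : i ∈ S <;> simp [h])
    rw [← Equiv.sum_comp e, Finset.mul_sum]
    refine Finset.sum_congr rfl fun S _ => ?_
    by_cases h : i ∈ S
    · have he : e S = S.erase i := if_pos h
      rw [he, Finset.card_erase_of_mem h, ← Finset.mul_prod_erase S z h]
      simp only [h, if_true]
      ring
    · have he : e S = insert i S := if_neg h
      rw [he, Finset.card_insert_of_notMem h, Finset.prod_insert h]
      simp only [h, if_false]
      linear_combination (g (S.card + 1) * ∏ j ∈ S, z j) * hz i
  rw [Finset.sum_mul, Finset.sum_congr rfl fun i _ => key i, Finset.sum_comm]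
  refine Finset.sum_congr rfl fun S _ => ?_
  rw [← Finset.sum_mul, Finset.sum_ite]
  congr 1
  simp only [Finset.sum_const, nsmul_eq_mul, Finset.filter_not, Finset.filter_univ_mem]
  rw [Finset.card_sdiff_of_subset (Finset.subset_univ S), Finset.card_univ,
    Nat.cast_sub (Finset.card_le_univ S)]

lemma sum_card_eq_sum_choose {n : ℕ} (f : ℕ → ℝ) :
    ∑ S : Finset (Fin n), f S.card = ∑ j ∈ Finset.range (n + 1), (n.choose j : ℝ) * f j := by
  simpa using Finset.sum_powerset_apply_card f (x := (Finset.univ : Finset (Fin n)))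

lemma sum_choose_mul_eq {n : ℕ} {θ : ℝ} {g h : ℕ → ℝ}
    (hrec : ∀ j ≤ n, (j : ℝ) * g (j - 1) + ((n : ℝ) - j) * g (j + 1) = θ * g j + h j) :
    ((n : ℝ) - θ) * ∑ j ∈ Finset.range (n + 1), (n.choose j : ℝ) * g j =
      ∑ j ∈ Finset.range (n + 1), (n.choose j : ℝ) * h j := by
  have := sum_mul_sum_prod_eq (fun _ : Fin n => (1 : ℝ)) (by simp) g
  have hc : ∀ S : Finset (Fin n), S.card ≤ n := fun S => by simpa using S.card_le_univ
  simp only [Finset.prod_const_one, mul_one, Fintype.card_fin, hrec _ (hc _),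
    Finset.sum_add_distrib, ← Finset.mul_sum, sum_card_eq_sum_choose, Finset.sum_const,
    Finset.card_univ, nsmul_eq_mul] at this
  linarith

lemma sum_sign_mul_sign_eq {n : ℕ} (x y : Fin n → Bool) :
    ∑ i, (if x i then (-1 : ℝ) else 1) * (if y i then (-1 : ℝ) else 1) =
      (n : ℝ) - 2 * hammingDist x y := by
  have : ∀ i, (if x i then (-1 : ℝ) else 1) * (if y i then (-1 : ℝ) else 1) =
      1 - 2 * (if x i ≠ y i then 1 else 0) := by
    intro i
    cases x i <;> cases y i <;> norm_num
  rw [Finset.sum_congr rfl fun i _ => this i, Finset.sum_sub_distrib, ← Finset.mul_sum,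
    Finset.sum_boole]
  simp [hammingDist]

lemma card_mul_sum_choose_le {n : ℕ} {θ : ℝ} {g h : ℕ → ℝ} {C : Finset (Fin n → Bool)}
    (hC : C.Nonempty) (hg : ∀ j, 0 ≤ g j) (hh : ∀ j, 0 ≤ h j)
    (hrec : ∀ j ≤ n, (j : ℝ) * g (j - 1) + ((n : ℝ) - j) * g (j + 1) = θ * g j + h j)
    (hsep : ∀ x ∈ C, ∀ y ∈ C, x ≠ y → (n : ℝ) - 2 * hammingDist x y ≤ θ) :
    (C.card : ℝ) * ∑ j ∈ Finset.range (n + 1), (n.choose j : ℝ) * (h j * g j) ≤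
      ((n : ℝ) - θ) * (∑ j ∈ Finset.range (n + 1), (n.choose j : ℝ) * g j) ^ 2 := by
  have hCpos : (0 : ℝ) < C.card := by exact_mod_cast hC.card_pos
  let s : (Fin n → Bool) → Fin n → ℝ := fun x i => if x i then -1 else 1
  have hs : ∀ x i, s x i * s x i = 1 := by
    intro x i
    simp only [s]
    split_ifs <;> norm_num
  let χ : Finset (Fin n) → (Fin n → Bool) → ℝ := fun S x => ∏ i ∈ S, s x i
  have hχ : ∀ S x, χ S x * χ S x = 1 := fun S x => by
    simp only [χ, ← Finset.prod_mul_distrib, hs, Finset.prod_const_one]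
  let K : (ℕ → ℝ) → (Fin n → Bool) → (Fin n → Bool) → ℝ :=
    fun f x y => ∑ S : Finset (Fin n), f S.card * (χ S x * χ S y)
  have hc : ∀ S : Finset (Fin n), S.card ≤ n := fun S => by simpa using S.card_le_univ
  have hK : ∀ x y, K h x y = ((n : ℝ) - 2 * hammingDist x y - θ) * K g x y := by
    intro x y
    have := sum_mul_sum_prod_eq (fun i => s x i * s y i)
      (fun i => by rw [mul_mul_mul_comm, hs, hs, one_mul]) g
    rw [sum_sign_mul_sign_eq x y] at this
    simp only [Fintype.card_fin, hrec _ (hc _), Finset.prod_mul_distrib, add_mul,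
      Finset.sum_add_distrib, mul_assoc, ← Finset.mul_sum] at this
    simp only [K, χ]
    linear_combination -this
  have hdiag : ∀ x, K g x x = ∑ j ∈ Finset.range (n + 1), (n.choose j : ℝ) * g j := by
    intro x
    simp only [K, hχ, mul_one, sum_card_eq_sum_choose]
  have hupper : ∑ x ∈ C, ∑ y ∈ C, K h x y * K g x y ≤
      ∑ x ∈ C, ((n : ℝ) - θ) * (∑ j ∈ Finset.range (n + 1), (n.choose j : ℝ) * g j) ^ 2 := by
    refine Finset.sum_le_sum fun x hx => ?_
    rw [← Finset.add_sum_erase C _ hx]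
    have h1 : K h x x * K g x x =
        ((n : ℝ) - θ) * (∑ j ∈ Finset.range (n + 1), (n.choose j : ℝ) * g j) ^ 2 := by
      rw [hK, hdiag, hammingDist_self]
      push_cast
      ring
    have h2 : ∑ y ∈ C.erase x, K h x y * K g x y ≤ 0 := by
      refine Finset.sum_nonpos fun y hy => ?_
      rw [hK, mul_assoc]
      refine mul_nonpos_of_nonpos_of_nonneg ?_ (mul_self_nonneg _)
      have := hsep x hx y (Finset.mem_of_mem_erase hy) (Finset.ne_of_mem_erase hy).symm
      linarith
    linarith
  have hexp : ∑ x ∈ C, ∑ y ∈ C, K h x y * K g x y =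
      ∑ S : Finset (Fin n), ∑ T : Finset (Fin n),
        h S.card * g T.card * (∑ x ∈ C, χ S x * χ T x) ^ 2 := by
    have h1 : ∀ S T : Finset (Fin n), h S.card * g T.card * (∑ x ∈ C, χ S x * χ T x) ^ 2 =
        ∑ x ∈ C, ∑ y ∈ C, h S.card * (χ S x * χ S y) * (g T.card * (χ T x * χ T y)) := by
      intro S T
      rw [sq, Finset.sum_mul_sum, Finset.mul_sum]
      refine Finset.sum_congr rfl fun x _ => ?_
      rw [Finset.mul_sum]
      exact Finset.sum_congr rfl fun y _ => by ring
    simp only [h1, K, Finset.sum_mul_sum]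
    calc _ = ∑ x ∈ C, ∑ S : Finset (Fin n), ∑ y ∈ C, ∑ T : Finset (Fin n),
          h S.card * (χ S x * χ S y) * (g T.card * (χ T x * χ T y)) :=
          Finset.sum_congr rfl fun x _ => Finset.sum_comm
      _ = ∑ S : Finset (Fin n), ∑ x ∈ C, ∑ T : Finset (Fin n), ∑ y ∈ C,
          h S.card * (χ S x * χ S y) * (g T.card * (χ T x * χ T y)) := by
          rw [Finset.sum_comm]
          exact Finset.sum_congr rfl fun S _ => Finset.sum_congr rfl fun x _ => Finset.sum_comm
      _ = _ := Finset.sum_congr rfl fun S _ => Finset.sum_comm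
  have hlower : (C.card : ℝ) ^ 2 * ∑ j ∈ Finset.range (n + 1), (n.choose j : ℝ) * (h j * g j) ≤
      ∑ x ∈ C, ∑ y ∈ C, K h x y * K g x y := by
    rw [hexp, ← sum_card_eq_sum_choose fun j => h j * g j, Finset.mul_sum]
    refine Finset.sum_le_sum fun S _ => ?_
    have h0 : ∀ T ∈ (Finset.univ : Finset (Finset (Fin n))),
        0 ≤ h S.card * g T.card * (∑ x ∈ C, χ S x * χ T x) ^ 2 :=
      fun T _ => mul_nonneg (mul_nonneg (hh _) (hg _)) (sq_nonneg _)
    refine le_trans (le_of_eq ?_) (Finset.single_le_sum h0 (Finset.mem_univ S))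
    simp only [hχ, Finset.sum_const, nsmul_eq_mul, mul_one]
    ring
  rw [Finset.sum_const, nsmul_eq_mul] at hupper
  refine le_of_mul_le_mul_left ?_ hCpos
  calc _ = _ := by ring
    _ ≤ _ := hlower.trans hupper

open Matrix in
lemma hasEigenvalue_maxEig {m : ℕ} {M : Matrix (Fin (m + 1)) (Fin (m + 1)) ℝ}
    (hM : M.IsHermitian) : Module.End.HasEigenvalue (toLin' M) (maxEig M) := by
  have hne : {μ : ℝ | Module.End.HasEigenvalue (toLin' M) μ}.Nonempty := by
    refine ⟨hM.eigenvalues 0, Module.End.hasEigenvalue_of_hasEigenvector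
      (x := (hM.eigenvectorBasis 0).ofLp) (Module.End.hasEigenvector_iff.2 ⟨?_, ?_⟩)⟩
    · rw [Module.End.mem_eigenspace_iff, toLin'_apply, hM.mulVec_eigenvectorBasis]
    · intro h0
      exact hM.eigenvectorBasis.orthonormal.ne_zero 0 (by ext i; exact congrFun h0 i)
  exact hne.csSup_mem (Module.End.finite_hasEigenvalue _)

open Matrix in
lemma exists_mulVec_eq_maxEig_smul {m : ℕ} {M : Matrix (Fin (m + 1)) (Fin (m + 1)) ℝ}
    (hM : M.IsHermitian) : ∃ v, v ≠ 0 ∧ M *ᵥ v = maxEig M • v := by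
  obtain ⟨v, hv⟩ := (hasEigenvalue_maxEig hM).exists_hasEigenvector
  exact ⟨v, hv.2, by simpa using hv.apply_eq_smul⟩

lemma le_maxEig {m : ℕ} {M : Matrix (Fin m) (Fin m) ℝ} {μ : ℝ}
    (h : Module.End.HasEigenvalue (Matrix.toLin' M) μ) : μ ≤ maxEig M :=
  le_csSup (Module.End.finite_hasEigenvalue _).bddAbove h

open Matrix in
lemma posSemidef_maxEig_smul_one_sub {m : ℕ} {M : Matrix (Fin m) (Fin m) ℝ}
    (hM : M.IsHermitian) : (maxEig M • (1 : Matrix (Fin m) (Fin m) ℝ) - M).PosSemidef := by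
  have hN : (maxEig M • (1 : Matrix (Fin m) (Fin m) ℝ) - M).IsHermitian :=
    (isHermitian_one.smul (IsSelfAdjoint.all _)).sub hM
  rw [hN.posSemidef_iff_eigenvalues_nonneg]
  intro i
  have h1 := hN.mulVec_eigenvectorBasis i
  rw [sub_mulVec, smul_mulVec, one_mulVec] at h1
  have h2 : Module.End.HasEigenvalue (toLin' M) (maxEig M - hN.eigenvalues i) := by
    refine Module.End.hasEigenvalue_of_hasEigenvector
      (x := (hN.eigenvectorBasis i).ofLp) (Module.End.hasEigenvector_iff.2 ⟨?_, ?_⟩)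
    · rw [Module.End.mem_eigenspace_iff, toLin'_apply, sub_smul, ← h1]
      abel
    · intro h0
      exact hN.eigenvectorBasis.orthonormal.ne_zero i (by ext j; exact congrFun h0 j)
  have := le_maxEig h2
  simp only [Pi.zero_apply]
  linarith

open Matrix in
lemma dotProduct_mulVec_le_maxEig {m : ℕ} {M : Matrix (Fin m) (Fin m) ℝ}
    (hM : M.IsHermitian) (v : Fin m → ℝ) : v ⬝ᵥ M *ᵥ v ≤ maxEig M * (v ⬝ᵥ v) := by
  have := (posSemidef_maxEig_smul_one_sub hM).dotProduct_mulVec_nonneg v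
  rw [star_trivial, sub_mulVec, smul_mulVec, one_mulVec, dotProduct_sub, dotProduct_smul,
    smul_eq_mul] at this
  linarith

open Matrix in
lemma exists_nonneg_mulVec_eq_maxEig_smul {m : ℕ} {M : Matrix (Fin (m + 1)) (Fin (m + 1)) ℝ}
    (hM : M.IsHermitian) (hoff : ∀ i j, i ≠ j → 0 ≤ M i j) :
    ∃ v, v ≠ 0 ∧ (∀ i, 0 ≤ v i) ∧ M *ᵥ v = maxEig M • v := by
  obtain ⟨v, hv, hMv⟩ := exists_mulVec_eq_maxEig_smul hM
  have hle : v ⬝ᵥ M *ᵥ v ≤ |v| ⬝ᵥ M *ᵥ |v| := by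
    simp only [dotProduct, mulVec, Finset.mul_sum]
    refine Finset.sum_le_sum fun i _ => Finset.sum_le_sum fun j _ => ?_
    simp only [Pi.abs_apply]
    by_cases hij : i = j
    · subst hij
      refine le_of_eq ?_
      linear_combination -M i i * abs_mul_abs_self (v i)
    · have h1 : v i * v j ≤ |v i| * |v j| := by
        rw [← abs_mul]
        exact le_abs_self _
      nlinarith [mul_le_mul_of_nonneg_left h1 (hoff i j hij)]
  have hsq : |v| ⬝ᵥ |v| = v ⬝ᵥ v := by
    simp [dotProduct]
  have hge := dotProduct_mulVec_le_maxEig hM |v|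
  rw [hMv, dotProduct_smul, smul_eq_mul] at hle
  have hzero : |v| ⬝ᵥ (maxEig M • (1 : Matrix (Fin (m + 1)) (Fin (m + 1)) ℝ) - M) *ᵥ |v| = 0 := by
    rw [sub_mulVec, smul_mulVec, one_mulVec, dotProduct_sub, dotProduct_smul, smul_eq_mul]
    rw [hsq] at hge ⊢
    linarith
  have := ((posSemidef_maxEig_smul_one_sub hM).dotProduct_mulVec_zero_iff |v|).1
    (by rwa [star_trivial])
  rw [sub_mulVec, smul_mulVec, one_mulVec, sub_eq_zero] at this
  exact ⟨|v|, by simpa using hv, fun i => abs_nonneg _, this.symm⟩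

open Matrix in
lemma maxEig_le_maxEig_of_posSemidef_sub {m : ℕ} {M N : Matrix (Fin (m + 1)) (Fin (m + 1)) ℝ}
    (hM : M.IsHermitian) (hN : N.IsHermitian) (h : (N - M).PosSemidef) :
    maxEig M ≤ maxEig N := by
  obtain ⟨v, hv, hMv⟩ := exists_mulVec_eq_maxEig_smul hM
  have h1 := h.dotProduct_mulVec_nonneg v
  rw [star_trivial, sub_mulVec, dotProduct_sub, hMv, dotProduct_smul, smul_eq_mul] at h1
  have h2 := dotProduct_mulVec_le_maxEig hN v
  have h3 : 0 < v ⬝ᵥ v := by simpa using dotProduct_star_self_pos_iff.2 hv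
  exact le_of_mul_le_mul_right (by linarith) h3

open Matrix in
lemma maxEig_submatrix_castSucc_le {m : ℕ} {M : Matrix (Fin (m + 2)) (Fin (m + 2)) ℝ}
    (hM : M.IsHermitian) : maxEig (M.submatrix Fin.castSucc Fin.castSucc) ≤ maxEig M := by
  obtain ⟨u, hu, hMu⟩ := exists_mulVec_eq_maxEig_smul (hM.submatrix Fin.castSucc)
  have h1 := dotProduct_mulVec_le_maxEig hM (Fin.snoc (α := fun _ => ℝ) u 0)
  have h2 : Fin.snoc (α := fun _ => ℝ) u 0 ⬝ᵥ M *ᵥ Fin.snoc (α := fun _ => ℝ) u 0 =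
      u ⬝ᵥ M.submatrix Fin.castSucc Fin.castSucc *ᵥ u := by
    simp [dotProduct, mulVec, Fin.sum_univ_castSucc (n := m + 1)]
  have h3 : Fin.snoc (α := fun _ => ℝ) u 0 ⬝ᵥ Fin.snoc (α := fun _ => ℝ) u 0 = u ⬝ᵥ u := by
    simp [dotProduct, Fin.sum_univ_castSucc (n := m + 1)]
  rw [h2, h3, hMu, dotProduct_smul, smul_eq_mul] at h1
  have h4 : 0 < u ⬝ᵥ u := by simpa using dotProduct_star_self_pos_iff.2 hu
  exact le_of_mul_le_mul_right h1 h4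

lemma isHermitian_tridiag (k : ℕ) (d o : ℕ → ℝ) : (Tridiag k d o).IsHermitian := by
  ext i j
  simp only [Tridiag, Matrix.conjTranspose_apply, Matrix.of_apply, star_trivial]
  split_ifs <;> first | rfl | omega | simp_all

lemma tridiag_sub_tridiag (k : ℕ) (d d' o : ℕ → ℝ) :
    Tridiag k d o - Tridiag k d' o = Matrix.diagonal fun i : Fin (k + 1) => d i - d' i := by
  ext i j
  simp only [Tridiag, Matrix.sub_apply, Matrix.of_apply, Matrix.diagonal_apply, Fin.ext_iff]
  split_ifs <;> simp

lemma submatrix_castSucc_tridiag {m : ℕ} {d d' : ℕ → ℝ} (o : ℕ → ℝ)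
    (h : ∀ i ≤ m, d i = d' i) :
    (Tridiag (m + 1) d o).submatrix Fin.castSucc Fin.castSucc = Tridiag m d' o := by
  ext i j
  simp [Tridiag, h i (Nat.lt_succ_iff.1 i.2)]

open Matrix in
lemma tridiag_mulVec {k : ℕ} (d o : ℕ → ℝ) {w : ℕ → ℝ} (hw : ∀ j, k < j → w j = 0)
    (i : Fin (k + 1)) :
    (Tridiag k d o *ᵥ fun j => w j) i =
      d i * w i + o i * w (i + 1) + if 0 < (i : ℕ) then o (i - 1) * w (i - 1) else 0 := by
  obtain ⟨i, hi⟩ := i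
  let f : ℕ → ℝ := fun j =>
    ((if j = i then d i * w i else 0) + if j = i + 1 then o i * w (i + 1) else 0) +
      if j = i - 1 then (if 0 < i then o (i - 1) * w (i - 1) else 0) else 0
  have h1 : (Tridiag k d o *ᵥ fun j => w j) ⟨i, hi⟩ = ∑ j ∈ Finset.range (k + 1), f j := by
    rw [← Fin.sum_univ_eq_sum_range]
    simp only [mulVec, dotProduct, f]
    refine Finset.sum_congr rfl fun j _ => ?_
    obtain ⟨j, hj⟩ := j
    simp only [Tridiag, of_apply]
    rcases lt_trichotomy i j with h | h | h
    · by_cases h' : j = i + 1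
      · subst h'
        simp [show i + 1 ≠ i - 1 by omega]
      · simp [h', h.ne, h.ne', Ne.symm h', show j + 1 ≠ i by omega, show j ≠ i - 1 by omega]
    · subst h
      by_cases h' : 0 < i
      · simp [show i ≠ i - 1 by omega]
      · simp [h']
    · obtain ⟨t, rfl⟩ := Nat.exists_eq_add_of_lt h
      by_cases h' : t = 0
      · subst h'
        simp [show j + 1 + 1 ≠ j by omega, show j ≠ j + 1 + 1 by omega]
      · simp [h', show j + t + 1 ≠ j by omega, show j ≠ j + t + 1 by omega, show j ≠ j + t + 1 + 1 by omega,
          show j + t + 1 + 1 ≠ j by omega]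
  simp only [h1, f]
  rw [Finset.sum_add_distrib, Finset.sum_add_distrib, Finset.sum_ite_eq', Finset.sum_ite_eq',
    Finset.sum_ite_eq']
  have h2 : i - 1 < k + 1 := by omega
  simp only [Finset.mem_range, hi, h2, if_true]
  by_cases h3 : i + 1 < k + 1
  · simp [h3]
  · simp [h3, hw (i + 1) (by omega)]

lemma exists_nonneg_tridiag_eigenseq (k : ℕ) (d : ℕ → ℝ) {o : ℕ → ℝ} (ho : ∀ i < k, 0 < o i) :
    ∃ w : ℕ → ℝ, (∀ j, 0 ≤ w j) ∧ 0 < w k ∧ (∀ j, k < j → w j = 0) ∧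
      ∀ j ≤ k, d j * w j + o j * w (j + 1) + (if 0 < j then o (j - 1) * w (j - 1) else 0) =
        maxEig (Tridiag k d o) * w j := by
  obtain ⟨v, hv, hv0, hMv⟩ := exists_nonneg_mulVec_eq_maxEig_smul (isHermitian_tridiag k d o) (by
    intro i j hij
    have := Fin.val_ne_of_ne hij
    simp only [Tridiag, Matrix.of_apply]
    split_ifs
    · omega
    · exact (ho _ (by omega)).le
    · exact (ho _ (by omega)).le
    · exact le_rfl)
  let w : ℕ → ℝ := fun j => if hj : j < k + 1 then v ⟨j, hj⟩ else 0
  have hwv : (fun j : Fin (k + 1) => w j) = v := by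
    ext j
    exact dif_pos j.2
  have hw0 : ∀ j, 0 ≤ w j := by
    intro j
    simp only [w]
    split_ifs
    · exact hv0 _
    · exact le_rfl
  have hwk : ∀ j, k < j → w j = 0 := fun j hj => dif_neg (by omega)
  have hrow : ∀ j ≤ k, d j * w j + o j * w (j + 1) +
      (if 0 < j then o (j - 1) * w (j - 1) else 0) = maxEig (Tridiag k d o) * w j := by
    intro j hj
    have h1 := tridiag_mulVec d o hwk ⟨j, Nat.lt_succ_of_le hj⟩
    rw [hwv, hMv, ← hwv] at h1
    simpa using h1.symm
  refine ⟨w, hw0, lt_of_le_of_ne (hw0 k) fun hk => hv ?_, hwk, hrow⟩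
  have hall : ∀ t ≤ k, w (k - t) = 0 ∧ w (k - t + 1) = 0 := by
    intro t
    induction t with
    | zero => exact fun _ => ⟨hk.symm, hwk _ (by omega)⟩
    | succ t ih =>
      intro ht
      obtain ⟨h1, h2⟩ := ih (by omega)
      have h3 := hrow (k - t) (by omega)
      rw [h1, h2, if_pos (by omega), show k - t - 1 = k - (t + 1) by omega] at h3
      refine ⟨?_, by rwa [show k - (t + 1) + 1 = k - t by omega]⟩
      have := ho (k - (t + 1)) (by omega)
      simpa [this.ne'] using h3
  rw [← hwv]
  ext j
  have := (hall (k - j) (by omega)).1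
  rwa [show k - (k - (j : ℕ)) = j by omega] at this

lemma sqrt_mul_sqrt_choose {n j : ℕ} (hj : j ≤ n) :
    Real.sqrt (((j : ℝ) + 1) * ((n : ℝ) - j)) * Real.sqrt (n.choose j) =
      ((j : ℝ) + 1) * Real.sqrt (n.choose (j + 1)) := by
  have h : (n.choose (j + 1) : ℝ) * (j + 1) = n.choose j * ((n : ℝ) - j) := by
    rw [← Nat.cast_sub hj]
    exact_mod_cast Nat.choose_succ_right_eq n j
  have h1 : (0 : ℝ) ≤ (n : ℝ) - j := sub_nonneg.2 (Nat.cast_le.2 hj)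
  rw [← Real.sqrt_mul (by positivity), ← Real.sqrt_sq (show (0 : ℝ) ≤ (j : ℝ) + 1 by positivity),
    ← Real.sqrt_mul (by positivity), Real.sqrt_sq (by positivity)]
  congr 1
  linear_combination -((j : ℝ) + 1) * h

lemma sqrt_mul_sqrt_choose_succ {n j : ℕ} (hj : j ≤ n) :
    Real.sqrt (((j : ℝ) + 1) * ((n : ℝ) - j)) * Real.sqrt (n.choose (j + 1)) =
      ((n : ℝ) - j) * Real.sqrt (n.choose j) := by
  have h : (n.choose (j + 1) : ℝ) * (j + 1) = n.choose j * ((n : ℝ) - j) := by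
    rw [← Nat.cast_sub hj]
    exact_mod_cast Nat.choose_succ_right_eq n j
  have h1 : (0 : ℝ) ≤ (n : ℝ) - j := sub_nonneg.2 (Nat.cast_le.2 hj)
  rw [← Real.sqrt_mul (by positivity), ← Real.sqrt_sq h1,
    ← Real.sqrt_mul (by positivity), Real.sqrt_sq h1]
  congr 1
  linear_combination ((n : ℝ) - j) * h

/-- The spectral bound (8) for binary codes in the Hamming space `{0,1}^n`. -/
theorem binary_code_spectral_bound (n d k : ℕ) (hn : 0 < n) (hd : 0 < d)
    (hk1 : 1 ≤ k) (hkn : k ≤ n)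
    (hcond1 : (n : ℝ) - 2 * d
      ≤ maxEig (Tridiag (k - 1) (fun _ => 0)
          (fun i => Real.sqrt (((i : ℝ) + 1) * ((n : ℝ) - i)))))
    (hcond2 : maxEig (Tridiag k (fun _ => 0)
          (fun i => Real.sqrt (((i : ℝ) + 1) * ((n : ℝ) - i)))) < (n : ℝ))
    (C : Finset (Fin n → Bool))
    (hdist : ∀ x ∈ C, ∀ y ∈ C, x ≠ y → d ≤ hammingDist x y) :
    (C.card : ℝ) ≤ 4 * ((n : ℝ) - k) * (Nat.choose n k)
      / ((n : ℝ) - maxEig (Tridiag k (fun _ => 0)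
          (fun i => Real.sqrt (((i : ℝ) + 1) * ((n : ℝ) - i))))) := by
  obtain ⟨m, rfl⟩ : ∃ m, k = m + 1 := ⟨k - 1, by omega⟩
  rw [Nat.add_sub_cancel] at hcond1
  set k := m + 1 with hk
  set o : ℕ → ℝ := fun i => Real.sqrt (((i : ℝ) + 1) * ((n : ℝ) - i)) with ho
  have hkn' : (0 : ℝ) ≤ (n : ℝ) - k := sub_nonneg.2 (Nat.cast_le.2 hkn)
  let δ : ℕ → ℝ := fun i => if i = k then -((n : ℝ) - k) else 0
  set θ := maxEig (Tridiag k δ o) with hθ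
  have hθ_le : θ ≤ maxEig (Tridiag k (fun _ => 0) o) := by
    refine maxEig_le_maxEig_of_posSemidef_sub (isHermitian_tridiag _ _ _)
      (isHermitian_tridiag _ _ _) ?_
    rw [tridiag_sub_tridiag, Matrix.posSemidef_diagonal_iff]
    intro i
    simp only [δ]
    split_ifs <;> simp [hkn]
  have hle_θ : (n : ℝ) - 2 * d ≤ θ := by
    refine hcond1.trans ?_
    rw [← submatrix_castSucc_tridiag (d := δ) o (fun i hi => if_neg (by omega))]
    exact maxEig_submatrix_castSucc_le (isHermitian_tridiag _ _ _)
  have hopos : ∀ i < k, 0 < o i := by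
    intro i hi
    have : (0 : ℝ) < (n : ℝ) - i := sub_pos.2 (Nat.cast_lt.2 (by omega))
    exact Real.sqrt_pos.2 (by positivity)
  obtain ⟨w, hw0, hwk_pos, hwk, hrow⟩ := exists_nonneg_tridiag_eigenseq k δ hopos
  rw [← hθ] at hrow
  have hcpos : ∀ j ≤ n, 0 < Real.sqrt (n.choose j) := fun j hj =>
    Real.sqrt_pos.2 (Nat.cast_pos.2 (Nat.choose_pos hj))
  let g : ℕ → ℝ := fun j => w j / Real.sqrt (n.choose j)
  have hg0 : ∀ j, 0 ≤ g j := fun j => div_nonneg (hw0 j) (Real.sqrt_nonneg _)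
  have hgk_pos : 0 < g k := div_pos hwk_pos (hcpos k hkn)
  have hgk : ∀ j, k < j → g j = 0 := fun j hj => by simp [g, hwk j hj]
  have hwg : ∀ j, w j = g j * Real.sqrt (n.choose j) := by
    intro j
    by_cases hj : j ≤ n
    · exact (div_mul_cancel₀ _ (hcpos j hj).ne').symm
    · rw [hwk j (by omega), hgk j (by omega), zero_mul]
  let h : ℕ → ℝ := fun j => (if j = k then ((n : ℝ) - k) * g k else 0) +
    if j = k + 1 then ((k : ℝ) + 1) * g k else 0
  have hh0 : ∀ j, 0 ≤ h j := by
    intro j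
    refine add_nonneg ?_ ?_ <;> split_ifs <;> positivity
  have hrec : ∀ j ≤ n, (j : ℝ) * g (j - 1) + ((n : ℝ) - j) * g (j + 1) = θ * g j + h j := by
    intro j hj
    rcases lt_trichotomy j (k + 1) with hjk | rfl | hjk
    · have h1 := hrow j (by omega)
      have h2 : (if 0 < j then o (j - 1) * w (j - 1) else 0) =
          j * g (j - 1) * Real.sqrt (n.choose j) := by
        rcases j with _ | j
        · simp
        · have := sqrt_mul_sqrt_choose (n := n) (j := j) (by omega)
          simp only [Nat.succ_pos, if_true, Nat.add_sub_cancel, hwg j, ho]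
          push_cast
          linear_combination g j * this
      have h3 : o j * w (j + 1) = ((n : ℝ) - j) * g (j + 1) * Real.sqrt (n.choose j) := by
        rw [hwg (j + 1)]
        linear_combination g (j + 1) * sqrt_mul_sqrt_choose_succ hj
      have h4 : h j = -δ j * g j := by
        simp only [h, δ, hjk.ne, if_false, add_zero]
        split_ifs with hjk'
        · rw [hjk', neg_neg]
        · simp
      rw [h2, h3, hwg j] at h1
      refine mul_right_cancel₀ (hcpos j hj).ne' ?_
      rw [h4]
      linear_combination h1
    · rw [hgk (k + 1) (by omega), hgk (k + 1 + 1) (by omega)]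
      simp [h]
    · rw [hgk j (by omega), hgk (j + 1) (by omega), hgk (j - 1) (by omega)]
      simp [h, hjk.ne', show j ≠ k by omega]
  have hchoose : (n.choose (k + 1) : ℝ) * (k + 1) = n.choose k * ((n : ℝ) - k) := by
    rw [← Nat.cast_sub hkn]
    exact_mod_cast Nat.choose_succ_right_eq n k
  have hsum_h : ∑ j ∈ Finset.range (n + 1), (n.choose j : ℝ) * h j =
      2 * ((n : ℝ) - k) * n.choose k * g k := by
    simp only [h, mul_add, mul_ite, mul_zero, Finset.sum_add_distrib, Finset.sum_ite_eq',
      Finset.mem_range]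
    rw [if_pos (by omega)]
    split_ifs with hlt
    · linear_combination g k * hchoose
    · rw [Nat.choose_eq_zero_of_lt (by omega : n < k + 1)] at hchoose
      push_cast at hchoose
      linear_combination g k * hchoose
  have hsum_hg : ∑ j ∈ Finset.range (n + 1), (n.choose j : ℝ) * (h j * g j) =
      ((n : ℝ) - k) * n.choose k * g k ^ 2 := by
    rw [Finset.sum_eq_single k]
    · simp only [h, if_true, show k ≠ k + 1 by omega, if_false]
      ring
    · intro j _ hj
      rcases eq_or_ne j (k + 1) with rfl | hj'
      · rw [hgk (k + 1) (by omega)]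
        ring
      · simp [h, hj, hj']
    · intro hnot
      exact absurd (Finset.mem_range.2 (by omega)) hnot
  have hchoose_pos : (0 : ℝ) < n.choose k := Nat.cast_pos.2 (Nat.choose_pos hkn)
  have hG := sum_choose_mul_eq hrec
  rw [hsum_h] at hG
  set G := ∑ j ∈ Finset.range (n + 1), (n.choose j : ℝ) * g j with hGdef
  have hGpos : 0 < G := by
    refine lt_of_lt_of_le (mul_pos hchoose_pos hgk_pos) ?_
    exact Finset.single_le_sum (f := fun j => (n.choose j : ℝ) * g j)
      (fun j _ => mul_nonneg (Nat.cast_nonneg _) (hg0 j)) (Finset.mem_range.2 (by omega))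
  have hnθ : 0 < (n : ℝ) - θ := by linarith
  have hnk_pos : (0 : ℝ) < (n : ℝ) - k := by
    refine lt_of_le_of_ne hkn' fun h0 => ?_
    rw [← h0] at hG
    have := mul_pos hnθ hGpos
    linarith
  have hgap : 0 < (n : ℝ) - maxEig (Tridiag k (fun _ => 0) o) := sub_pos.2 hcond2
  rcases C.eq_empty_or_nonempty with rfl | hC
  · rw [Finset.card_empty, Nat.cast_zero]
    positivity
  have hmain := card_mul_sum_choose_le hC hg0 hh0 hrec (by
    intro x hx y hy hxy
    have : (d : ℝ) ≤ hammingDist x y := Nat.cast_le.2 (hdist x hx y hy hxy)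
    linarith)
  rw [hsum_hg, ← hGdef] at hmain
  have hbound : (C.card : ℝ) * ((n : ℝ) - θ) ≤ 4 * ((n : ℝ) - k) * n.choose k := by
    have hpos : 0 < ((n : ℝ) - k) * n.choose k * g k ^ 2 := by positivity
    refine le_of_mul_le_mul_right ?_ hpos
    calc _ = (C.card : ℝ) * (((n : ℝ) - k) * n.choose k * g k ^ 2) * ((n : ℝ) - θ) := by ring
      _ ≤ ((n : ℝ) - θ) * G ^ 2 * ((n : ℝ) - θ) := mul_le_mul_of_nonneg_right hmain hnθ.le
      _ = (((n : ℝ) - θ) * G) ^ 2 := by ring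
      _ = _ := by rw [hG]; ring
  rw [le_div_iff₀ hgap]
  refine le_trans ?_ hbound
  exact mul_le_mul_of_nonneg_left (by linarith) (Nat.cast_nonneg _)
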